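/- arXiv:1801.07608 — 4 statements merged into one kernel-verified Lean document; each statement's English description precedes it below -/
import Mathlib

section
/- Let p, q be positive coprime integers, set α = p/q, let y ∈ ℝ and let f : ℝ → ℝ be a 1-periodic function, and define ĝ(m) := (1/q)·Σ_{k=0}^{q−1} f(y + kα)·e^{−2πiαkm}. Let φ : ℝ → ℂ be continuous and 1-periodic, with Fourier coefficients φ̂(z) = ∫₀¹ φ(x)e^{−2πizx} dx that are nonnegative reals satisfying Σ_{z∈ℤ} φ̂(z) < ∞ and φ(x) = Σ_{z∈ℤ} φ̂(z)e^{2πizx} for all x. Then Σ_{z∈ℤ} φ̂(z)·[(1/q)·Σ_{l=0}^{q−1} f(y + lα)·f(y + (l−z)α)] = Σ_{m=0}^{q−1} |ĝ(m)|²·φ(mα), all series converging absolutely. -/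
open Complex Real

/-- Orthogonality of the characters of a cyclic group, with exponents in `ℤ`. -/
lemma IsPrimitiveRoot.sum_range_zpow_mul {K : Type*} [Field K] {ζ : K} {q : ℕ}
    (h : IsPrimitiveRoot ζ q) (j : ℤ) :
    ∑ m ∈ Finset.range q, ζ ^ (j * m) = if (q : ℤ) ∣ j then (q : K) else 0 := by
  simp only [zpow_mul, zpow_natCast]
  split_ifs with hj
  · simp [(h.zpow_eq_one_iff_dvd j).2 hj]
  · have h1 : ζ ^ j ≠ 1 := fun h1 => hj ((h.zpow_eq_one_iff_dvd j).1 h1)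
    rw [geom_sum_eq h1, ← zpow_natCast, ← zpow_mul, mul_comm, zpow_mul, zpow_natCast, h.pow_eq_one]
    simp

/-- Summing a `q`-periodic function over a residue class within one period. -/
lemma sum_range_ite_dvd_eq {M : Type*} [AddCommMonoid M] {q : ℕ} (hq : 0 < q) {F : ℤ → M}
    (hF : Function.Periodic F q) (a : ℤ) :
    ∑ l ∈ Finset.range q, (if (q : ℤ) ∣ l - a then F l else 0) = F a := by
  have hq' : (0 : ℤ) < q := by exact_mod_cast hq
  have hnn := Int.emod_nonneg a hq'.ne'
  have hlt := Int.emod_lt_of_pos a hq'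
  have hcast : (((a % q).toNat : ℕ) : ℤ) = a % q := Int.toNat_of_nonneg hnn
  rw [Finset.sum_eq_single (a % q).toNat]
  · have hmod : F (a % q) = F a := by
      have := hF.int_mul (a / q) (a % q)
      rw [← this]
      congr 1
      simpa [mul_comm] using Int.emod_add_mul_ediv a q
    rw [hcast, if_pos (by rw [← dvd_neg, neg_sub]; exact Int.dvd_self_sub_emod), hmod]
  · intro l hl hne
    rw [if_neg]
    intro hd
    apply hne
    have hl' : (l : ℤ) < q := by exact_mod_cast Finset.mem_range.1 hl
    have h1 : (l : ℤ) % q = a % q :=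
      Int.emod_eq_emod_iff_emod_sub_eq_zero.2 (Int.emod_eq_zero_of_dvd hd)
    rw [Int.emod_eq_of_lt (by positivity) hl'] at h1
    omega
  · intro h
    exact absurd (Finset.mem_range.2 (by omega)) h

/-- The inverse discrete Fourier transform of the power spectrum of a `q`-periodic real
sequence is its cyclic autocorrelation. -/
lemma sum_norm_sq_dft_mul_zpow {q : ℕ} (hq : 0 < q) {ζ : ℂ} (hζ : IsPrimitiveRoot ζ q)
    {F : ℤ → ℝ} (hF : Function.Periodic F q) (z : ℤ) :
    ∑ m ∈ Finset.range q,
        ((‖(1 / (q : ℂ)) * ∑ k ∈ Finset.range q, (F k : ℂ) * ζ ^ (-(k * m : ℤ))‖ ^ 2 : ℝ) : ℂ)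
          * ζ ^ (z * m)
      = (((1 / (q : ℝ)) * ∑ l ∈ Finset.range q, F l * F (l - z) : ℝ) : ℂ) := by
  have hq0 : (q : ℂ) ≠ 0 := by exact_mod_cast hq.ne'
  have hζ0 : ζ ≠ 0 := hζ.ne_zero hq.ne'
  have hconj : (starRingEnd ℂ) ζ = ζ⁻¹ :=
    (Complex.inv_eq_conj (hζ.norm'_eq_one hq.ne')).symm
  have hterm (m : ℕ) :
      ((‖(1 / (q : ℂ)) * ∑ k ∈ Finset.range q, (F k : ℂ) * ζ ^ (-(k * m : ℤ))‖ ^ 2 : ℝ) : ℂ)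
          * ζ ^ (z * m)
        = (1 / (q : ℂ) ^ 2) * ∑ k ∈ Finset.range q, ∑ l ∈ Finset.range q,
            (F k : ℂ) * F l * ζ ^ ((l - (k - z) : ℤ) * m) := by
    push_cast
    rw [← Complex.mul_conj']
    simp only [map_mul, map_sum, map_div₀, map_one, map_natCast, Complex.conj_ofReal, map_zpow₀,
      hconj]
    rw [mul_mul_mul_comm, Finset.sum_mul_sum, mul_assoc, Finset.sum_mul]
    congr 1
    · field_simp
    refine Finset.sum_congr rfl fun k _ => ?_
    rw [Finset.sum_mul]
    refine Finset.sum_congr rfl fun l _ => ?_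
    have : ζ ^ ((l - (k - z) : ℤ) * m) =
        ζ ^ (-(k * m : ℤ)) * ζ⁻¹ ^ (-(l * m : ℤ)) * ζ ^ (z * m) := by
      rw [inv_zpow', ← zpow_add₀ hζ0, ← zpow_add₀ hζ0]
      congr 1
      ring
    rw [this]
    ring
  have hFc : Function.Periodic (fun l : ℤ => (F l : ℂ)) q := fun l => by simp [hF l]
  have hinner (k : ℕ) : ∑ m ∈ Finset.range q, ∑ l ∈ Finset.range q,
      (F k : ℂ) * F l * ζ ^ ((l - (k - z) : ℤ) * m) = q * (F k * F (k - z)) := by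
    rw [Finset.sum_comm, ← sum_range_ite_dvd_eq hq hFc (k - z), Finset.mul_sum, Finset.mul_sum]
    refine Finset.sum_congr rfl fun l _ => ?_
    rw [← Finset.mul_sum, hζ.sum_range_zpow_mul]
    split_ifs <;> ring
  simp only [hterm]
  rw [← Finset.mul_sum, Finset.sum_comm, Finset.sum_congr rfl fun k _ => hinner k,
    ← Finset.mul_sum]
  push_cast
  field_simp

/-- For a rational rotation number `α = p/q` and a 1-periodic observable `f`,
pairing the autocorrelation coefficients against the Fourier coefficients of a
nice test function `φ` gives `Σ_{m<q} |ĝ(m)|² φ(mα)`, all series converging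
absolutely. -/
theorem rational_rotation_diffraction_pairing
    (p q : ℕ) (hp : 0 < p) (hq : 0 < q) (hpq : Nat.Coprime p q)
    (α : ℝ) (hα : α = (p : ℝ) / q) (y : ℝ)
    (f : ℝ → ℝ) (hper : Function.Periodic f 1)
    (ghat : ℤ → ℂ)
    (hghat : ∀ m : ℤ, ghat m = (1 / (q : ℂ)) * ∑ k ∈ Finset.range q,
        (f (y + k * α) : ℂ) * Complex.exp (-(2 * π * I * α * k * m)))
    (φ : ℝ → ℂ) (hφcont : Continuous φ) (hφper : Function.Periodic φ 1)
    (φhat : ℤ → ℂ)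
    (hφhat : ∀ z : ℤ, φhat z = ∫ x in (0:ℝ)..1, φ x * Complex.exp (-(2 * π * I * z * x)))
    (hφhatnn : ∀ z : ℤ, 0 ≤ (φhat z).re ∧ (φhat z).im = 0)
    (hφhatsum : Summable (fun z : ℤ => (φhat z).re))
    (hφrep : ∀ x : ℝ, φ x = ∑' z : ℤ, φhat z * Complex.exp (2 * π * I * z * x)) :
    Summable (fun z : ℤ =>
      ‖φhat z * (((1 / (q : ℝ)) *
          ∑ l ∈ Finset.range q, f (y + l * α) * f (y + ((l : ℝ) - (z : ℝ)) * α) : ℝ) : ℂ)‖) ∧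
    ∑' z : ℤ, φhat z * (((1 / (q : ℝ)) *
        ∑ l ∈ Finset.range q, f (y + l * α) * f (y + ((l : ℝ) - (z : ℝ)) * α) : ℝ) : ℂ)
      = ∑ m ∈ Finset.range q, ((‖ghat m‖ ^ 2 : ℝ) : ℂ) * φ (m * α) := by
  have hq0 : (q : ℝ) ≠ 0 := by exact_mod_cast hq.ne'
  set ζ : ℂ := Complex.exp (2 * π * I * (p / q)) with hζdef
  have hζ : IsPrimitiveRoot ζ q := Complex.isPrimitiveRoot_exp_of_coprime p q hq.ne' hpq
  have hexp (n : ℤ) : ζ ^ n = Complex.exp (2 * π * I * α * n) := by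
    rw [hζdef, ← Complex.exp_int_mul, hα]
    congr 1
    push_cast
    ring
  have hF : Function.Periodic (fun k : ℤ => f (y + k * α)) q := fun k => by
    have h := hper.nat_mul p (y + k * α)
    simp only [← h]
    congr 1
    rw [hα]
    push_cast
    field_simp
    ring
  have hg (m : ℕ) : ghat m = (1 / (q : ℂ)) * ∑ k ∈ Finset.range q,
      (f (y + ((k : ℤ) : ℝ) * α) : ℂ) * ζ ^ (-(k * m : ℤ)) := by
    rw [hghat]
    congr 1
    refine Finset.sum_congr rfl fun k _ => ?_
    rw [hexp]
    push_cast
    congr 2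
    ring
  have key (z : ℤ) : (((1 / (q : ℝ)) *
      ∑ l ∈ Finset.range q, f (y + l * α) * f (y + ((l : ℝ) - (z : ℝ)) * α) : ℝ) : ℂ)
      = ∑ m ∈ Finset.range q, ((‖ghat m‖ ^ 2 : ℝ) : ℂ) *
          Complex.exp (2 * π * I * z * ((m * α : ℝ) : ℂ)) := by
    have h := sum_norm_sq_dft_mul_zpow hq hζ hF z
    simp only [Int.cast_natCast, Int.cast_sub] at h
    rw [← h]
    refine Finset.sum_congr rfl fun m _ => ?_
    rw [hg m, hexp]
    simp only [Int.cast_natCast]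
    congr 2
    push_cast
    ring
  have hnorm : Summable fun z : ℤ => ‖φhat z‖ := by
    refine hφhatsum.congr fun z => ?_
    rw [← Complex.abs_re_eq_norm.2 (hφhatnn z).2, abs_of_nonneg (hφhatnn z).1]
  have hsum (x : ℝ) : Summable fun z : ℤ => φhat z * Complex.exp (2 * π * I * z * x) := by
    refine Summable.of_norm (hnorm.congr fun z => ?_)
    have : (2 * π * I * z * x : ℂ) = ((2 * π * z * x : ℝ) : ℂ) * I := by push_cast; ring
    rw [norm_mul, this, Complex.norm_exp_ofReal_mul_I, mul_one]
  have hterm (z : ℤ) : φhat z * (((1 / (q : ℝ)) *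
      ∑ l ∈ Finset.range q, f (y + l * α) * f (y + ((l : ℝ) - (z : ℝ)) * α) : ℝ) : ℂ)
      = ∑ m ∈ Finset.range q, ((‖ghat m‖ ^ 2 : ℝ) : ℂ) *
          (φhat z * Complex.exp (2 * π * I * z * ((m * α : ℝ) : ℂ))) := by
    rw [key, Finset.mul_sum]
    exact Finset.sum_congr rfl fun m _ => by ring
  simp only [hterm]
  refine ⟨(summable_sum fun m _ => (hsum _).mul_left _).norm, ?_⟩
  rw [Summable.tsum_finsetSum fun m _ => (hsum _).mul_left _]
  refine Finset.sum_congr rfl fun m _ => ?_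
  rw [tsum_mul_left, ← hφrep]
end

section
/- Let α ∈ ℝ be irrational, let f : ℝ → ℝ be a bounded measurable 1-periodic function with Fourier coefficients f̂(m) = ∫₀¹ f(x)e^{−2πimx} dx, and let φ : ℝ → ℂ be continuous and 1-periodic, with Fourier coefficients φ̂(z) = ∫₀¹ φ(x)e^{−2πizx} dx that are nonnegative reals satisfying Σ_{z∈ℤ} φ̂(z) < ∞ and φ(x) = Σ_{z∈ℤ} φ̂(z)e^{2πizx} for all x. Then Σ_{z∈ℤ} φ̂(z)·∫₀¹ f(x)·f(x − zα) dx = Σ_{m∈ℤ} |f̂(m)|²·φ(mα), both series converging absolutely. -/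
open Complex Real

open MeasureTheory ComplexConjugate

/-- The Fourier coefficient of the lift to the circle of a function on `(0, 1]`. -/
lemma fourierCoeff_liftIoc_zero_one [Fact ((0 : ℝ) < 1)] (f : ℝ → ℂ) (m : ℤ) :
    fourierCoeff (AddCircle.liftIoc (1 : ℝ) 0 f) m =
      ∫ x in (0:ℝ)..1, f x * Complex.exp (-(2 * π * I * m * x)) := by
  rw [fourierCoeff_eq_intervalIntegral _ _ 0, zero_add, div_one, one_smul,
    intervalIntegral.integral_of_le zero_le_one, intervalIntegral.integral_of_le zero_le_one]
  refine setIntegral_congr_fun measurableSet_Ioc fun x hx => ?_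
  rw [AddCircle.liftIoc_coe_apply (by simpa using hx), fourier_coe_apply, smul_eq_mul, mul_comm]
  congr 2
  push_cast
  ring

/-- Polarized Parseval identity on `(0, 1]`. -/
lemma hasSum_conj_mul_fourier_integral {f g : ℝ → ℂ}
    (hf : MemLp f 2 (volume.restrict (Set.Ioc 0 1)))
    (hg : MemLp g 2 (volume.restrict (Set.Ioc 0 1))) :
    HasSum (fun m : ℤ => conj (∫ x in (0:ℝ)..1, f x * Complex.exp (-(2 * π * I * m * x))) *
        ∫ x in (0:ℝ)..1, g x * Complex.exp (-(2 * π * I * m * x)))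
      (∫ x in (0:ℝ)..1, conj (f x) * g x) := by
  have : Fact ((0 : ℝ) < 1) := ⟨one_pos⟩
  rw [← zero_add (1 : ℝ)] at hf hg
  have hF := hf.memLp_liftIoc.haarAddCircle
  have hG := hg.memLp_liftIoc.haarAddCircle
  convert! fourierBasis.hasSum_inner_mul_inner hF.toLp hG.toLp using 1
  · ext m
    rw [← inner_conj_symm, ← HilbertBasis.repr_apply_apply, ← HilbertBasis.repr_apply_apply,
      fourierBasis_repr, fourierBasis_repr, fourierCoeff_congr_ae hF.coeFn_toLp,
      fourierCoeff_congr_ae hG.coeFn_toLp, fourierCoeff_liftIoc_zero_one,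
      fourierCoeff_liftIoc_zero_one]
  · rw [L2.inner_def]
    have h := AddCircle.integral_liftIoc_eq_intervalIntegral (T := 1) (t := 0)
      (f := fun x => conj (f x) * g x)
    rw [zero_add] at h
    have h_haar := AddCircle.integral_haarAddCircle (T := 1)
      (f := AddCircle.liftIoc (1 : ℝ) 0 fun x => conj (f x) * g x)
    rw [inv_one, one_smul] at h_haar
    rw [← h, ← h_haar]
    apply integral_congr_ae
    filter_upwards [hF.coeFn_toLp, hG.coeFn_toLp] with x hx hy
    rw [hx, hy, RCLike.inner_apply']
    rfl

/-- Translating a 1-periodic function multiplies its Fourier coefficients by a character. -/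
lemma integral_comp_sub_mul_exp {f : ℝ → ℂ} (hper : Function.Periodic f 1) (t : ℝ) (m : ℤ) :
    ∫ x in (0:ℝ)..1, f (x - t) * Complex.exp (-(2 * π * I * m * x)) =
      Complex.exp (-(2 * π * I * m * t)) *
        ∫ x in (0:ℝ)..1, f x * Complex.exp (-(2 * π * I * m * x)) := by
  set h : ℝ → ℂ := fun x => f x * Complex.exp (-(2 * π * I * m * x)) with hh
  have h_per : Function.Periodic h 1 := by
    intro x
    simp only [hh, hper x]
    congr 1
    rw [Complex.exp_eq_exp_iff_exists_int]
    exact ⟨-m, by push_cast; ring⟩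
  have h_shift : ∀ x : ℝ, f (x - t) * Complex.exp (-(2 * π * I * m * x)) =
      Complex.exp (-(2 * π * I * m * t)) * h (x - t) := by
    intro x
    simp only [hh]
    rw [mul_left_comm, ← Complex.exp_add]
    congr 2
    push_cast
    ring
  simp_rw [h_shift]
  rw [intervalIntegral.integral_const_mul, intervalIntegral.integral_comp_sub_right h t]
  congr 1
  have := h_per.intervalIntegral_add_eq (0 - t) 0
  rwa [zero_add, show 0 - t + 1 = 1 - t by ring] at this

/-- The autocorrelation of a bounded 1-periodic function as the Fourier series of its
power spectrum. -/
lemma hasSum_autocorrelation {f : ℝ → ℝ} (hmeas : Measurable f)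
    (hbdd : ∃ C : ℝ, ∀ x, |f x| ≤ C) (hper : Function.Periodic f 1) (t : ℝ) :
    HasSum (fun m : ℤ =>
        ((‖∫ x in (0:ℝ)..1, (f x : ℂ) * Complex.exp (-(2 * π * I * m * x))‖ ^ 2 : ℝ) : ℂ) *
          Complex.exp (2 * π * I * m * t))
      ((∫ x in (0:ℝ)..1, f x * f (x - t) : ℝ) : ℂ) := by
  obtain ⟨C, hC⟩ := hbdd
  have hLp : ∀ s : ℝ, MemLp (fun x => (f (x - s) : ℂ)) 2 (volume.restrict (Set.Ioc 0 1)) :=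
    fun s => MemLp.of_bound
      (Complex.measurable_ofReal.comp
        (hmeas.comp (measurable_id.sub_const s))).aestronglyMeasurable C
      (Filter.Eventually.of_forall fun x => by simpa using hC (x - s))
  have hLp0 : MemLp (fun x => (f x : ℂ)) 2 (volume.restrict (Set.Ioc 0 1)) := by
    simpa using hLp 0
  convert! hasSum_conj_mul_fourier_integral (hLp t) hLp0 using 1
  · ext m
    rw [integral_comp_sub_mul_exp (f := fun x => (f x : ℂ)) (fun x => by simp only [hper x]) t m,
      map_mul, mul_assoc (conj _), Complex.conj_mul', ← Complex.exp_conj, mul_comm]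
    congr 2
    · simp [map_ofNat]
    · push_cast; rfl
  · rw [← intervalIntegral.integral_ofReal]
    congr 1
    ext x
    simp [mul_comm]

/-- For an irrational rotation number `α` and a bounded measurable 1-periodic `f`,
pairing the autocorrelation coefficients `Ξ(z) = ∫₀¹ f(x) f(x−zα) dx` against the
Fourier coefficients of a nice test function `φ` gives `Σ_m |f̂(m)|² φ(mα)`, both
series converging absolutely. -/
theorem irrational_rotation_diffraction_pairing
    (α : ℝ) (hα : Irrational α)
    (f : ℝ → ℝ) (hmeas : Measurable f) (hbdd : ∃ C : ℝ, ∀ x, |f x| ≤ C)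
    (hper : Function.Periodic f 1)
    (fhat : ℤ → ℂ)
    (hfhat : ∀ m : ℤ, fhat m = ∫ x in (0:ℝ)..1, (f x : ℂ) * Complex.exp (-(2 * π * I * m * x)))
    (φ : ℝ → ℂ) (hφcont : Continuous φ) (hφper : Function.Periodic φ 1)
    (φhat : ℤ → ℂ)
    (hφhat : ∀ z : ℤ, φhat z = ∫ x in (0:ℝ)..1, φ x * Complex.exp (-(2 * π * I * z * x)))
    (hφhatnn : ∀ z : ℤ, 0 ≤ (φhat z).re ∧ (φhat z).im = 0)
    (hφhatsum : Summable (fun z : ℤ => (φhat z).re))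
    (hφrep : ∀ x : ℝ, φ x = ∑' z : ℤ, φhat z * Complex.exp (2 * π * I * z * x)) :
    Summable (fun z : ℤ =>
      ‖φhat z * ((∫ x in (0:ℝ)..1, f x * f (x - z * α) : ℝ) : ℂ)‖) ∧
    Summable (fun m : ℤ => ‖((‖fhat m‖ ^ 2 : ℝ) : ℂ) * φ (m * α)‖) ∧
    ∑' z : ℤ, φhat z * ((∫ x in (0:ℝ)..1, f x * f (x - z * α) : ℝ) : ℂ)
      = ∑' m : ℤ, ((‖fhat m‖ ^ 2 : ℝ) : ℂ) * φ (m * α) := by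
  have hpars : ∀ z : ℤ, HasSum (fun m : ℤ => ((‖fhat m‖ ^ 2 : ℝ) : ℂ) *
      Complex.exp (2 * π * I * z * ((m * α : ℝ) : ℂ)))
      ((∫ x in (0:ℝ)..1, f x * f (x - z * α) : ℝ) : ℂ) := by
    intro z
    convert! hasSum_autocorrelation hmeas hbdd hper (z * α) using 1
    ext m
    rw [hfhat m]
    congr 2
    push_cast
    ring
  have hsq : Summable fun m : ℤ => ‖fhat m‖ ^ 2 := by
    have h := (hpars 0).summable
    simp only [Int.cast_zero, mul_zero, zero_mul, Complex.exp_zero, mul_one] at h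
    exact Complex.summable_ofReal.mp h
  set F : ℤ × ℤ → ℂ := fun p => φhat p.1 * (((‖fhat p.2‖ ^ 2 : ℝ) : ℂ) *
    Complex.exp (2 * π * I * p.1 * ((p.2 * α : ℝ) : ℂ))) with hF
  have hexp : ∀ (z : ℤ) (x : ℝ), ‖Complex.exp (2 * π * I * z * (x : ℂ))‖ = 1 := by
    intro z x
    rw [Complex.norm_exp]
    simp
  have hre : ∀ z : ℤ, ‖φhat z‖ = (φhat z).re := by
    intro z
    rw [← Complex.abs_re_eq_norm.mpr (hφhatnn z).2, abs_of_nonneg (hφhatnn z).1]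
  have hFsum : Summable F := by
    refine Summable.of_norm ?_
    refine (hφhatsum.mul_of_nonneg hsq (fun z => (hφhatnn z).1) fun m => sq_nonneg _).congr ?_
    rintro ⟨z, m⟩
    simp only [hF]
    rw [norm_mul, norm_mul, hexp, hre, mul_one, Complex.norm_real, Real.norm_of_nonneg (sq_nonneg _)]
  have hrow : ∀ z : ℤ, ∑' m : ℤ, F (z, m) =
      φhat z * ((∫ x in (0:ℝ)..1, f x * f (x - z * α) : ℝ) : ℂ) :=
    fun z => ((hpars z).mul_left (φhat z)).tsum_eq
  have hcol : ∀ m : ℤ, ∑' z : ℤ, F (z, m) = ((‖fhat m‖ ^ 2 : ℝ) : ℂ) * φ (m * α) := by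
    intro m
    rw [hφrep, ← tsum_mul_left]
    exact tsum_congr fun z => mul_left_comm _ _ _
  refine ⟨?_, ?_, ?_⟩
  · exact (hFsum.prod.congr hrow).norm
  · exact (hFsum.prod_symm.prod.congr hcol).norm
  · rw [← tsum_congr hrow, ← tsum_congr hcol]
    exact (hFsum.tsum_comm (f := fun z m => F (z, m))).symm
end

section
/- Let f : ℝ → ℝ be 1-periodic, bounded, nonnegative, and such that its set of discontinuity points has Lebesgue measure zero. Let y ∈ [0,1), let α > 0, and let (α_i)_{i∈ℕ} be a sequence of positive reals with α_i ≠ α for all i and lim_{i→∞} α_i = α. For each i define Ξ_i : ℤ → ℝ by: Ξ_i(z) = (1/q_i)·Σ_{k=0}^{q_i−1} f(y + kα_i)·f(y + (k−z)α_i) if α_i = p_i/q_i is rational with p_i, q_i positive coprime integers, and Ξ_i(z) = ∫₀¹ f(x)·f(x − zα_i) dx if α_i is irrational. Then for every z ∈ ℤ, lim_{i→∞} Ξ_i(z) = ∫₀¹ f(x)·f(x − zα) dx. -/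
open MeasureTheory Filter

/-- A function on `ℝ` that is continuous at almost every point is a.e. strongly measurable. -/
theorem aestronglyMeasurable_of_ae_continuousAt {f : ℝ → ℝ}
    (hdisc : volume {x : ℝ | ¬ ContinuousAt f x} = 0) : AEStronglyMeasurable f volume := by
  have hc : ContinuousOn f {x | ContinuousAt f x} := fun x hx => hx.continuousWithinAt
  have hm : MeasurableSet {x | ContinuousAt f x} := (IsGδ.setOfPred_continuousAt f).measurableSet
  have h := hc.aestronglyMeasurable (μ := volume) hm
  rwa [Measure.restrict_eq_self_of_ae_mem (show ∀ᵐ x, x ∈ {x | ContinuousAt f x} from hdisc)] at h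

theorem tendsto_integral_mul_of_ae_continuousAt {f : ℝ → ℝ} {C : ℝ} (hC : ∀ x, |f x| ≤ C)
    (hdisc : volume {x : ℝ | ¬ ContinuousAt f x} = 0) {ι : Type*} {l : Filter ι}
    [l.IsCountablyGenerated] (y : ℝ) {s : ι → ℝ → ℝ} {a : ι → ℝ} {b : ℝ}
    (hs : ∀ x, Tendsto (fun i => s i x) l (nhds x)) (ha : Tendsto a l (nhds b))
    (hm : ∀ᶠ i in l, AEStronglyMeasurable (fun x => f (y + s i x) * f (y + s i x - a i)) volume) :
    Tendsto (fun i => ∫ x in (0:ℝ)..1, f (y + s i x) * f (y + s i x - a i)) l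
      (nhds (∫ x in (0:ℝ)..1, f (y + x) * f (y + x - b))) := by
  have hae : ∀ᵐ x : ℝ, ContinuousAt f x := hdisc
  have h1 : ∀ᵐ x : ℝ, ContinuousAt f (y + x) :=
    (measurePreserving_add_left volume y).quasiMeasurePreserving.ae hae
  have h2 : ∀ᵐ x : ℝ, ContinuousAt f (y + x - b) :=
    ((measurePreserving_sub_right volume b).comp
      (measurePreserving_add_left volume y)).quasiMeasurePreserving.ae hae
  refine intervalIntegral.tendsto_integral_filter_of_dominated_convergence (fun _ => C * C)
    (hm.mono fun i hi => hi.restrict) (Eventually.of_forall fun i => ae_of_all _ fun x _ => ?_)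
    intervalIntegrable_const ?_
  · rw [Real.norm_eq_abs, abs_mul]
    exact mul_le_mul (hC _) (hC _) (abs_nonneg _) ((abs_nonneg _).trans (hC 0))
  · filter_upwards [h1, h2] with x hx1 hx2 _
    have hy := (hs x).const_add y
    exact (hx1.tendsto.comp hy).mul (hx2.tendsto.comp (hy.sub ha))

/-- A left Riemann sum over `[0, 1]` as the integral of a step function. -/
theorem riemannSum_eq_integral_ceil (g : ℝ → ℝ) {q : ℕ} (hq : 0 < q) :
    (1 / (q : ℝ)) * ∑ k ∈ Finset.range q, g (k / q) =
      ∫ x in (0:ℝ)..1, g ((⌈(q : ℝ) * x⌉ - 1) / q) := by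
  have hq' : (0 : ℝ) < q := by exact_mod_cast hq
  have hcongr : ∀ k : ℕ, ∀ x ∈ Set.uIoc ((k : ℝ) / q) ((k + 1 : ℕ) / q),
      g (k / q) = g ((⌈(q : ℝ) * x⌉ - 1) / q) := by
    intro k x hx
    rw [Set.uIoc_of_le (by gcongr; omega), Set.mem_Ioc, div_lt_iff₀ hq', le_div_iff₀ hq'] at hx
    have : ⌈(q : ℝ) * x⌉ = (k : ℤ) + 1 := by
      rw [Int.ceil_eq_iff]
      push_cast at hx ⊢
      constructor <;> linarith
    rw [this]
    push_cast
    rw [add_sub_cancel_right]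
  have hint : ∀ k < q, IntervalIntegrable (fun x => g ((⌈(q : ℝ) * x⌉ - 1) / q)) volume
      ((k : ℝ) / q) ((k + 1 : ℕ) / q) := fun k _ =>
    (intervalIntegrable_const (c := g (k / q))).congr (hcongr k)
  have hsum := intervalIntegral.sum_integral_adjacent_intervals (a := fun k : ℕ => (k : ℝ) / q) hint
  simp only [Nat.cast_zero, zero_div, div_self hq'.ne'] at hsum
  rw [← hsum, Finset.mul_sum]
  refine Finset.sum_congr rfl fun k _ => ?_
  rw [← intervalIntegral.integral_congr_ae (ae_of_all _ (hcongr k)),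
    intervalIntegral.integral_const, smul_eq_mul]
  push_cast
  ring

/-- The orbit of a rotation by `p / q` in lowest terms runs through all multiples of `1 / q`. -/
theorem sum_range_mul_div_of_coprime {g : ℝ → ℝ} (hg : Function.Periodic g 1) {p q : ℕ}
    (hq : 0 < q) (hpq : Nat.Coprime p q) :
    ∑ k ∈ Finset.range q, g ((k : ℝ) * (p / q)) = ∑ k ∈ Finset.range q, g (k / q) := by
  have hmaps : Set.MapsTo (fun k => k * p % q) (Finset.range q) (Finset.range q) :=
    fun k _ => by simpa using Nat.mod_lt _ hq
  have hinj : Set.InjOn (fun k => k * p % q) (Finset.range q) := by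
    intro k hk m hm h
    simp only [Finset.coe_range, Set.mem_Iio] at hk hm
    have h' : k ≡ m [MOD q] := Nat.ModEq.cancel_right_of_coprime hpq.symm h
    exact h'.eq_of_lt_of_lt hk hm
  refine Finset.sum_nbij (fun k => k * p % q) hmaps hinj
    (Finset.surjOn_of_injOn_of_card_le _ hmaps hinj le_rfl) fun k _ => ?_
  have hq' : (q : ℝ) ≠ 0 := by exact_mod_cast hq.ne'
  have hdiv : ((k * p % q : ℕ) : ℝ) + q * (k * p / q : ℕ) = k * p := by
    exact_mod_cast Nat.mod_add_div (k * p) q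
  have : (k : ℝ) * (p / q) = (k * p % q : ℕ) / q + (k * p / q : ℕ) * 1 := by
    field_simp
    linarith
  rw [this]
  exact hg.nat_mul _ _

theorem rational_correlation_eq_integral {f : ℝ → ℝ} (hper : Function.Periodic f 1) (y a : ℝ)
    {p q : ℕ} (hq : 0 < q) (hpq : Nat.Coprime p q) :
    (1 / (q : ℝ)) * ∑ k ∈ Finset.range q,
        f (y + (k : ℝ) * (p / q)) * f (y + (k : ℝ) * (p / q) - a) =
      ∫ x in (0:ℝ)..1, f (y + (⌈(q : ℝ) * x⌉ - 1) / q) * f (y + (⌈(q : ℝ) * x⌉ - 1) / q - a) := by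
  have hg : Function.Periodic (fun t => f (y + t) * f (y + t - a)) 1 := fun t => by
    dsimp only
    rw [← add_assoc, hper, add_sub_right_comm, hper]
  rw [sum_range_mul_div_of_coprime hg hq hpq]
  exact riemannSum_eq_integral_ceil (fun t => f (y + t) * f (y + t - a)) hq

/-- Rationals converging to a limit they avoid have denominators tending to infinity. -/
theorem tendsto_den_atTop_of_tendsto_ne {ι : Type*} {l : Filter ι} {r : ι → ℚ} {a : ℝ}
    (h : Tendsto (fun i => (r i : ℝ)) l (nhds a)) (hne : ∀ᶠ i in l, (r i : ℝ) ≠ a) :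
    Tendsto (fun i => (r i).den) l atTop := by
  refine tendsto_atTop.2 fun N => ?_
  set M : ℝ := (N.factorial : ℝ)
  have hM : M ≠ 0 := Nat.cast_ne_zero.2 N.factorial_ne_zero
  have hclosed : IsClosed ((Int.cast : ℤ → ℝ) '' {m | (m : ℝ) ≠ M * a}) :=
    Int.isClosedEmbedding_coe_real.isClosedMap _ (isClosed_discrete _)
  have hev := (h.const_mul M).eventually (hclosed.isOpen_compl.mem_nhds
    (x := M * a) (by rintro ⟨m, hm, hma⟩; exact hm hma))
  filter_upwards [hev, hne] with i hi hi'
  by_contra! hlt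
  obtain ⟨c, hc⟩ := Nat.dvd_factorial (r i).den_pos hlt.le
  have hcast : ((c * (r i).num : ℤ) : ℝ) = M * r i := by
    have hd : ((r i).den : ℝ) ≠ 0 := by exact_mod_cast (r i).den_ne_zero
    simp only [M, hc, Rat.cast_def (r i)]
    push_cast
    field_simp
  refine hi ⟨c * (r i).num, ?_, hcast⟩
  simpa [hcast, hM] using hi'

theorem tendsto_ceil_sub_one_div {ι : Type*} {l : Filter ι} {q : ι → ℕ}
    (hq : Tendsto q l atTop) (x : ℝ) :
    Tendsto (fun i => ((⌈(q i : ℝ) * x⌉ : ℝ) - 1) / q i) l (nhds x) := by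
  have hinv : Tendsto (fun i => 1 / (q i : ℝ)) l (nhds 0) :=
    tendsto_one_div_atTop_nhds_zero_nat.comp hq
  have hlow : Tendsto (fun i => x - 1 / (q i : ℝ)) l (nhds x) := by
    simpa using hinv.const_sub x
  have hpos : ∀ᶠ i in l, (0 : ℝ) < q i :=
    (hq.eventually_gt_atTop 0).mono fun i hi => by exact_mod_cast hi
  refine tendsto_of_tendsto_of_tendsto_of_le_of_le' hlow tendsto_const_nhds ?_ ?_
  · filter_upwards [hpos] with i hi
    rw [le_div_iff₀ hi, sub_mul, one_div_mul_cancel hi.ne']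
    linarith [Int.le_ceil ((q i : ℝ) * x)]
  · filter_upwards [hpos] with i hi
    rw [div_le_iff₀ hi]
    linarith [Int.ceil_lt_add_one ((q i : ℝ) * x)]

/-- The correlation integral over a period does not depend on the base point. -/
theorem integral_correlation_const_add {f : ℝ → ℝ} (hper : Function.Periodic f 1) (y a : ℝ) :
    ∫ x in (0:ℝ)..1, f (y + x) * f (y + x - a) = ∫ x in (0:ℝ)..1, f x * f (x - a) := by
  have hg : Function.Periodic (fun t => f t * f (t - a)) 1 := fun t => by
    dsimp only
    rw [hper, add_sub_right_comm, hper]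
  rw [intervalIntegral.integral_comp_add_left (fun t => f t * f (t - a)) y]
  simpa using hg.intervalIntegral_add_eq y 0

/-- Convergence of the autocorrelation coefficients of the `f`-weighted return time
measures for rigid rotations with rotation numbers `α_i → α`, `α_i ≠ α`, with a fixed
reference point `y ∈ [0,1)`: for rational `α_i = p_i/q_i` in lowest terms the
coefficient is the discrete orbit correlation, for irrational `α_i` the continuous
correlation; in both cases `Ξ_i(z) → ∫₀¹ f(x) f(x − zα) dx`. -/
theorem rotation_autocorrelation_convergence_fixed_point
    (f : ℝ → ℝ) (hper : Function.Periodic f 1)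
    (hbdd : ∃ C : ℝ, ∀ x, |f x| ≤ C) (hnn : ∀ x, 0 ≤ f x)
    (hdisc : volume {x : ℝ | ¬ ContinuousAt f x} = 0)
    (y : ℝ) (hy : y ∈ Set.Ico (0:ℝ) 1)
    (α : ℝ) (hαpos : 0 < α)
    (αseq : ℕ → ℝ) (hseqpos : ∀ i, 0 < αseq i)
    (hne : ∀ i, αseq i ≠ α) (hlim : Tendsto αseq atTop (nhds α))
    (Ξ : ℕ → ℤ → ℝ)
    (hΞrat : ∀ i (p q : ℕ), 0 < p → 0 < q → Nat.Coprime p q → αseq i = (p : ℝ) / q →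
      ∀ z : ℤ, Ξ i z = (1 / (q : ℝ)) *
        ∑ k ∈ Finset.range q, f (y + (k : ℝ) * αseq i) * f (y + ((k : ℝ) - (z : ℝ)) * αseq i))
    (hΞirr : ∀ i, Irrational (αseq i) →
      ∀ z : ℤ, Ξ i z = ∫ x in (0:ℝ)..1, f x * f (x - (z : ℝ) * αseq i)) :
    ∀ z : ℤ,
      Tendsto (fun i => Ξ i z) atTop
        (nhds (∫ x in (0:ℝ)..1, f x * f (x - (z : ℝ) * α))) := by
  intro z
  obtain ⟨C, hC⟩ := hbdd
  have hza : Tendsto (fun i => (z : ℝ) * αseq i) atTop (nhds (z * α)) := hlim.const_mul _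
  rw [← integral_correlation_const_add hper y]
  have hsplit : (atTop : Filter ℕ) =
      atTop ⊓ Filter.principal {i | Irrational (αseq i)} ⊔ atTop ⊓ Filter.principal {i | Irrational (αseq i)}ᶜ := by
    rw [← inf_sup_left, sup_principal, Set.union_compl_self, principal_univ, inf_top_eq]
  rw [hsplit]
  refine Tendsto.sup ?_ ?_
  · have hfm := aestronglyMeasurable_of_ae_continuousAt hdisc
    refine (tendsto_integral_mul_of_ae_continuousAt hC hdisc y (s := fun _ x => x)
      (fun x => tendsto_const_nhds) (hza.mono_left inf_le_left)
      (Eventually.of_forall fun i => ?_)).congr' ?_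
    · have hy := measurePreserving_add_left (volume : Measure ℝ) y
      exact (hfm.comp_measurePreserving hy).mul
        (hfm.comp_measurePreserving ((measurePreserving_sub_right volume (z * αseq i)).comp hy))
    · filter_upwards [mem_inf_of_right (mem_principal_self _)] with i hi
      rw [hΞirr i hi z, integral_correlation_const_add hper y]
  · have hrat : ∀ i, ∃ r : ℚ, ¬ Irrational (αseq i) → (r : ℝ) = αseq i := fun i => by
      by_cases hi : Irrational (αseq i)
      · exact ⟨0, fun h => absurd hi h⟩
      · obtain ⟨r, hr⟩ := not_not.1 hi
        exact ⟨r, fun _ => hr⟩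
    choose r hr using hrat
    have hev : ∀ᶠ i in atTop ⊓ Filter.principal {i | Irrational (αseq i)}ᶜ, (r i : ℝ) = αseq i := by
      filter_upwards [mem_inf_of_right (mem_principal_self _)] with i hi using hr i hi
    have hden := tendsto_den_atTop_of_tendsto_ne
      ((hlim.mono_left inf_le_left).congr' (hev.mono fun i hi => hi.symm))
      (hev.mono fun i hi => hi ▸ hne i)
    refine (tendsto_integral_mul_of_ae_continuousAt hC hdisc y
      (tendsto_ceil_sub_one_div hden) (hza.mono_left inf_le_left)
      (Eventually.of_forall fun i => ?_)).congr' ?_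
    · have hceil : Measurable fun x : ℝ => ⌈((r i).den : ℝ) * x⌉ :=
        Int.measurable_ceil.comp (measurable_const_mul _)
      exact ((measurable_from_top (f := fun m : ℤ => f (y + ((m : ℝ) - 1) / (r i).den) *
        f (y + ((m : ℝ) - 1) / (r i).den - z * αseq i))).comp hceil).aestronglyMeasurable
    · filter_upwards [hev] with i hi
      have hpos : 0 < (r i).num := Rat.num_pos.2 (by exact_mod_cast hi ▸ hseqpos i)
      have hα : αseq i = ((r i).num.natAbs : ℝ) / (r i).den := by
        rw [← hi, Rat.cast_def, Nat.cast_natAbs, abs_of_pos hpos]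
      rw [hΞrat i _ _ (Int.natAbs_pos.2 hpos.ne') (r i).den_pos (r i).reduced hα z,
        ← rational_correlation_eq_integral hper y (z * αseq i) (r i).den_pos (r i).reduced, ← hα]
      simp only [sub_mul, add_sub_assoc]
end

section
/- Let p, q be positive coprime integers with p/q < 1/2, and let χ denote the indicator function of [0, (2p+1)/(2q)) ⊂ [0,1). Then ∫₀¹ χ(x)² dx = (2p+1)/(2q), while (1/q)·Σ_{m=0}^{q−1} χ(m/q)² = (p+1)/q; in particular these two values are distinct. -/
/-- The integral over `[0, 1]` of the squared indicator of `[0, c)`, for `c ∈ [0, 1]`, is `c`. -/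
theorem integral_indicator_Ico_sq {c : ℝ} (hc₀ : 0 ≤ c) (hc₁ : c ≤ 1) :
    ∫ x in (0:ℝ)..1, (Set.Ico (0:ℝ) c).indicator (fun _ => (1:ℝ)) x ^ 2 = c := by
  have hsq : ∀ x, (Set.Ico (0:ℝ) c).indicator (fun _ => (1:ℝ)) x ^ 2 =
      (Set.Ico (0:ℝ) c).indicator (fun _ => (1:ℝ)) x := fun x => by
    by_cases hx : x ∈ Set.Ico (0:ℝ) c <;> simp [hx]
  simp_rw [hsq]
  rw [intervalIntegral.integral_of_le zero_le_one, ← MeasureTheory.integral_Icc_eq_integral_Ioc,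
    MeasureTheory.setIntegral_indicator measurableSet_Ico,
    Set.inter_eq_self_of_subset_right
      (Set.Ico_subset_Icc_self.trans (Set.Icc_subset_Icc_right hc₁))]
  simp [hc₀]

/-- Among the points `m / q` with `m < q`, exactly `p + 1` lie in `[0, (2p+1)/(2q))`. -/
theorem sum_indicator_Ico_div_sq {p q : ℕ} (hpq : p < q) :
    ∑ m ∈ Finset.range q, (Set.Ico (0:ℝ) ((2 * (p : ℝ) + 1) / (2 * (q : ℝ)))).indicator
      (fun _ => (1:ℝ)) ((m : ℝ) / q) ^ 2 = (p : ℝ) + 1 := by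
  have hq : (0:ℝ) < q := by exact_mod_cast (Nat.zero_le p).trans_lt hpq
  have hmem : ∀ m : ℕ, (m : ℝ) / q ∈ Set.Ico (0:ℝ) ((2 * (p : ℝ) + 1) / (2 * (q : ℝ))) ↔
      m ∈ Finset.range (p + 1) := fun m => by
    have hm : (m : ℝ) / q = 2 * m / (2 * q) := by field_simp
    rw [Set.mem_Ico, and_iff_right (by positivity), hm, div_lt_div_iff_of_pos_right (by positivity),
      Finset.mem_range]
    norm_cast
    omega
  rw [← Finset.sum_subset (Finset.range_subset_range.2 (Nat.succ_le_of_lt hpq))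
      fun m _ hm => by rw [Set.indicator_of_notMem (mt (hmem m).1 hm)]; norm_num,
    Finset.sum_congr rfl fun m hm => by rw [Set.indicator_of_mem ((hmem m).2 hm)]]
  simp

/-- For coprime positive integers `p, q` with `p/q < 1/2` and `χ` the indicator of
`[0, (2p+1)/(2q))`, the continuous zeroth correlation `∫₀¹ χ² = (2p+1)/(2q)` differs
from the discrete one `(1/q) Σ_{m<q} χ(m/q)² = (p+1)/q`. -/
theorem indicator_correlation_discrete_ne_continuous
    (p q : ℕ) (hp : 0 < p) (hq : 0 < q) (hpq : Nat.Coprime p q)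
    (hlt : (p : ℝ) / q < 1 / 2)
    (χ : ℝ → ℝ)
    (hχ : χ = Set.indicator (Set.Ico (0:ℝ) ((2 * (p : ℝ) + 1) / (2 * (q : ℝ)))) (fun _ => (1:ℝ))) :
    (∫ x in (0:ℝ)..1, χ x ^ 2 = (2 * (p : ℝ) + 1) / (2 * (q : ℝ))) ∧
    (1 / (q : ℝ)) * ∑ m ∈ Finset.range q, χ ((m : ℝ) / q) ^ 2 = ((p : ℝ) + 1) / q ∧
    (2 * (p : ℝ) + 1) / (2 * (q : ℝ)) ≠ ((p : ℝ) + 1) / q := by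
  have hq_pos : (0:ℝ) < q := by exact_mod_cast hq
  have hlt_nat : 2 * p < q := by
    rw [div_lt_iff₀ hq_pos] at hlt
    have : (2:ℝ) * p < q := by linarith
    exact_mod_cast this
  have hle : 2 * (p:ℝ) + 1 ≤ q := by exact_mod_cast hlt_nat
  subst hχ
  refine ⟨integral_indicator_Ico_sq (by positivity) ?_, ?_, fun h => ?_⟩
  · rw [div_le_one (by positivity)]
    linarith
  · rw [sum_indicator_Ico_div_sq (by omega), one_div_mul_eq_div]
  · field_simp at h
    linarith
end
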